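/- For each n, let X_n ~ χ²(p; p δ²) and Y_n ~ χ²(m̃) be independent, where p/n → c ∈ (0,1), m̃ = n−k−p+1 with k/n → α ∈ [0,1), α+c < 1, and δ ≥ 0 is a fixed constant. Then √p ( X_n/Y_n − (p/m̃)(1+δ²) ) converges in distribution to a normal random variable with mean 0 and variance 2c²[(1−α)(1+2δ²) + cδ⁴]/(1−α−c)³. -/

import Mathlib

open MeasureTheory ProbabilityTheory Filter Topology

/-- The chi-square distribution with `d` degrees of freedom. -/
noncomputable def chiSqMeasure (d : ℕ) : Measure ℝ :=
  (Measure.pi (fun _ : Fin d => gaussianReal 0 1)).map (fun z => ∑ i, (z i) ^ 2)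

/-- The noncentral chi-square distribution with `p` degrees of freedom and noncentrality
parameter `μ'μ`. -/
noncomputable def noncentralChiSq (p : ℕ) (μ : Fin p → ℝ) : Measure ℝ :=
  (Measure.pi (fun _ : Fin p => gaussianReal 0 1)).map (fun z => ∑ i, (z i + μ i) ^ 2)

theorem norm_pow_sub_pow_le_of_norm_le_one {a b : ℂ} (ha : ‖a‖ ≤ 1) (hb : ‖b‖ ≤ 1) (n : ℕ) :
    ‖a ^ n - b ^ n‖ ≤ n * ‖a - b‖ := by
  induction n with
  | zero => simp
  | succ n ih =>
    have h : a ^ (n + 1) - b ^ (n + 1) = a ^ n * (a - b) + (a ^ n - b ^ n) * b := by ring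
    have h1 : ‖a ^ n * (a - b)‖ ≤ ‖a - b‖ := by
      rw [norm_mul, norm_pow]
      exact mul_le_of_le_one_left (norm_nonneg _) (pow_le_one₀ (norm_nonneg _) ha)
    have h2 : ‖(a ^ n - b ^ n) * b‖ ≤ n * ‖a - b‖ := by
      rw [norm_mul]
      exact (mul_le_of_le_one_right (norm_nonneg _) hb).trans ih
    rw [h]
    push_cast
    linarith [norm_add_le (a ^ n * (a - b)) ((a ^ n - b ^ n) * b)]

theorem integral_sq_gaussianReal : (∫ x, x ^ 2 ∂gaussianReal 0 1) = 1 := by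
  have h := variance_id_gaussianReal (μ := 0) (v := 1)
  rw [variance_eq_integral (by fun_prop)] at h
  simpa using h

theorem tendsto_charFun_pow_of_tendsto_mul_sq {Ω : Type*} [MeasurableSpace Ω] {P : Measure Ω}
    [IsProbabilityMeasure P] {U : Ω → ℝ} (hU : AEMeasurable U P) (h0 : P[U] = 0)
    (h1 : P[U ^ 2] = 1) {N : ℕ → ℕ} {s : ℕ → ℝ} {L : ℝ} (hs : Tendsto s atTop (𝓝 0))
    (hN : Tendsto (fun n => (N n : ℝ) * s n ^ 2) atTop (𝓝 L)) :
    Tendsto (fun n => charFun (P.map U) (s n) ^ N n) atTop (𝓝 (Complex.exp (-(L : ℂ) / 2))) := by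
  have : IsProbabilityMeasure (P.map U) := Measure.isProbabilityMeasure_map hU
  have hg := taylor_charFun_two (P := gaussianReal 0 1) (X := id) (by fun_prop)
    (by simp) (by simpa using integral_sq_gaussianReal)
  rw [Measure.map_id] at hg
  have hsub : (fun t : ℝ => charFun (P.map U) t - charFun (gaussianReal 0 1) t)
      =o[𝓝 0] fun t : ℝ => t ^ 2 :=
    ((taylor_charFun_two hU h0 h1).sub hg).congr_left fun t => by ring
  have ho := hsub.comp_tendsto hs
  have hgl : Tendsto (fun n => charFun (gaussianReal 0 1) (s n) ^ N n) atTop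
      (𝓝 (Complex.exp (-(L : ℂ) / 2))) := by
    have : ∀ n, charFun (gaussianReal 0 1) (s n) ^ N n
        = Complex.exp (-(((N n : ℝ) * s n ^ 2 : ℝ) : ℂ) / 2) := by
      intro n
      rw [charFun_gaussianReal, ← Complex.exp_nat_mul]
      congr 1
      push_cast
      ring
    simp_rw [this]
    exact ((Complex.continuous_exp.comp ((Complex.continuous_ofReal.neg).div_const 2)).tendsto
      L).comp hN
  have hz : Tendsto (fun n => charFun (P.map U) (s n) ^ N n
      - charFun (gaussianReal 0 1) (s n) ^ N n) atTop (𝓝 0) := by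
    have hb : (fun n => (N n : ℝ) * ‖charFun (P.map U) (s n) - charFun (gaussianReal 0 1) (s n)‖)
        =o[atTop] fun n => (N n : ℝ) * s n ^ 2 := by
      have := (Asymptotics.isBigO_refl (fun n => (N n : ℝ)) atTop).mul_isLittleO ho.norm_norm
      simpa [Function.comp_def] using! this
    have hb0 := (hb.trans_isBigO (hN.isBigO_one ℝ)).tendsto_zero_of_tendsto tendsto_const_nhds
    refine squeeze_zero_norm (fun n => ?_) hb0
    exact norm_pow_sub_pow_le_of_norm_le_one (norm_charFun_le_one _) (norm_charFun_le_one _) _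
  simpa using hz.add hgl

theorem hasDerivAt_integral_pow_mul_exp_gaussianReal (k : ℕ) (t : ℝ) :
    HasDerivAt (fun t => ∫ x, x ^ k * Real.exp (t * x) ∂gaussianReal 0 1)
      (∫ x, x ^ (k + 1) * Real.exp (t * x) ∂gaussianReal 0 1) t :=
  hasDerivAt_integral_pow_mul_exp_real (X := fun x : ℝ => x) (by simp) k

theorem integral_pow_mul_exp_gaussianReal (t : ℝ) :
    (∫ x, x ^ 3 * Real.exp (t * x) ∂gaussianReal 0 1) = (3 * t + t ^ 3) * Real.exp (t ^ 2 / 2) ∧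
    (∫ x, x ^ 4 * Real.exp (t * x) ∂gaussianReal 0 1)
      = (3 + 6 * t ^ 2 + t ^ 4) * Real.exp (t ^ 2 / 2) := by
  have he (t : ℝ) : HasDerivAt (fun t : ℝ => Real.exp (t ^ 2 / 2)) (t * Real.exp (t ^ 2 / 2)) t := by
    convert! (((hasDerivAt_id t).pow 2).div_const 2).exp using 1
    simp; ring
  have hstep (k : ℕ) (q q' : ℝ → ℝ) (hq : ∀ t, HasDerivAt q (q' t) t)
      (h : ∀ t, (∫ x, x ^ k * Real.exp (t * x) ∂gaussianReal 0 1) = q t * Real.exp (t ^ 2 / 2))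
      (t : ℝ) : (∫ x, x ^ (k + 1) * Real.exp (t * x) ∂gaussianReal 0 1)
        = (q' t + t * q t) * Real.exp (t ^ 2 / 2) := by
    have h1 := hasDerivAt_integral_pow_mul_exp_gaussianReal k t
    rw [funext h] at h1
    rw [h1.unique ((hq t).mul (he t))]
    ring
  have h0 (t : ℝ) : (∫ x, x ^ 0 * Real.exp (t * x) ∂gaussianReal 0 1)
      = 1 * Real.exp (t ^ 2 / 2) := by
    have := congrFun (mgf_fun_id_gaussianReal (μ := 0) (v := 1)) t
    simpa [mgf] using this
  have h1 := hstep 0 (fun _ => 1) (fun _ => 0) (fun t => hasDerivAt_const t 1) h0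
  have h2 := hstep 1 (fun t => t) (fun _ => 1) hasDerivAt_id fun t => by rw [h1]; ring
  have h3 := hstep 2 (fun t => 1 + t ^ 2) (fun t => 2 * t) (fun t => by
    simpa using ((hasDerivAt_id t).pow 2).const_add 1) fun t => by rw [h2]; ring
  have h4 := hstep 3 (fun t => 3 * t + t ^ 3) (fun t => 3 + 3 * t ^ 2) (fun t => by
    simpa using! ((hasDerivAt_id t).const_mul 3).add ((hasDerivAt_id t).pow 3))
    fun t => by rw [h3]; ring
  exact ⟨by rw [h3]; ring, by rw [h4]; ring⟩

theorem integrable_pow_gaussianReal (k : ℕ) : Integrable (fun x : ℝ => x ^ k) (gaussianReal 0 1) := by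
  have := (memLp_id_gaussianReal (μ := 0) (v := 1) k).integrable_norm_pow'
  refine (integrable_norm_iff (by fun_prop)).1 ?_
  simpa using this

theorem integral_pow_three_gaussianReal : (∫ x, x ^ 3 ∂gaussianReal 0 1) = 0 := by
  simpa using (integral_pow_mul_exp_gaussianReal 0).1

theorem integral_pow_four_gaussianReal : (∫ x, x ^ 4 ∂gaussianReal 0 1) = 3 := by
  simpa using (integral_pow_mul_exp_gaussianReal 0).2

theorem integral_sq_add_sub (δ : ℝ) :
    (∫ z, ((z + δ) ^ 2 - (1 + δ ^ 2)) ∂gaussianReal 0 1) = 0 := by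
  have h (z : ℝ) : (z + δ) ^ 2 - (1 + δ ^ 2) = z ^ 2 + 2 * δ * z ^ 1 - 1 := by ring
  simp_rw [h]
  have i (k : ℕ) := integrable_pow_gaussianReal k
  have i1 := (i 1).const_mul (2 * δ)
  rw [integral_sub ((i 2).fun_add i1) (integrable_const _), integral_add (i 2) i1, integral_const_mul, integral_sq_gaussianReal]
  simp

theorem integral_sq_sq_add_sub (δ : ℝ) :
    (∫ z, ((z + δ) ^ 2 - (1 + δ ^ 2)) ^ 2 ∂gaussianReal 0 1) = 2 + 4 * δ ^ 2 := by
  have h (z : ℝ) : ((z + δ) ^ 2 - (1 + δ ^ 2)) ^ 2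
      = z ^ 4 + 4 * δ * z ^ 3 + (4 * δ ^ 2 - 2) * z ^ 2 + (-4 * δ) * z ^ 1 + 1 := by ring
  simp_rw [h]
  have i (k : ℕ) := integrable_pow_gaussianReal k
  have i3 := (i 3).const_mul (4 * δ)
  have i2 := (i 2).const_mul (4 * δ ^ 2 - 2)
  have i1 := (i 1).const_mul (-4 * δ)
  rw [integral_add ((((i 4).fun_add i3).fun_add i2).fun_add i1) (integrable_const _),
    integral_add (((i 4).fun_add i3).fun_add i2) i1, integral_add ((i 4).fun_add i3) i2,
    integral_add (i 4) i3]
  simp only [integral_const_mul, integral_sq_gaussianReal, integral_pow_three_gaussianReal,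
    integral_pow_four_gaussianReal]
  simp
  ring

theorem charFun_map_const_mul_sub_noncentralChiSq {Ω : Type*} [MeasurableSpace Ω] {P : Measure Ω}
    {X : Ω → ℝ} {d : ℕ} {δ : ℝ} (hXm : AEMeasurable X P)
    (hX : P.map X = noncentralChiSq d (fun _ => δ)) (a t : ℝ) :
    charFun (P.map fun ω => a * (X ω - d * (1 + δ ^ 2))) t =
      charFun ((gaussianReal 0 1).map fun z => (z + δ) ^ 2 - (1 + δ ^ 2)) (a * t) ^ d := by
  have h1 : P.map (fun ω => a * (X ω - d * (1 + δ ^ 2)))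
      = (Measure.pi fun _ : Fin d => gaussianReal 0 1).map
        (fun z => a * ∑ i, ((z i + δ) ^ 2 - (1 + δ ^ 2))) := by
    have : P.map (fun ω => a * (X ω - d * (1 + δ ^ 2)))
        = (P.map X).map (fun x => a * (x - d * (1 + δ ^ 2))) := by
      rw [AEMeasurable.map_map_of_aemeasurable (by fun_prop) hXm]
      rfl
    rw [this, hX, noncentralChiSq, Measure.map_map (by fun_prop) (by fun_prop)]
    congr 1
    ext z
    simp only [Function.comp_apply, Finset.sum_sub_distrib, Finset.sum_const, Finset.card_univ,
      Fintype.card_fin, nsmul_eq_mul]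
  have hind := iIndepFun_pi (μ := fun _ : Fin d => gaussianReal 0 1)
    (X := fun _ z => (z + δ) ^ 2 - (1 + δ ^ 2)) (fun _ => by fun_prop)
  rw [h1, charFun_map_mul_comp (Measurable.aemeasurable (by fun_prop)),
    hind.charFun_map_fun_sum_eq_prod fun _ => Measurable.aemeasurable (by fun_prop)]
  have h2 (i : Fin d) : (Measure.pi fun _ : Fin d => gaussianReal 0 1).map
      (fun z => (z i + δ) ^ 2 - (1 + δ ^ 2))
      = (gaussianReal 0 1).map fun z => (z + δ) ^ 2 - (1 + δ ^ 2) := by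
    conv_rhs => rw [← (measurePreserving_eval (fun _ : Fin d => gaussianReal 0 1) i).map_eq,
      Measure.map_map (by fun_prop) (by fun_prop)]
    rfl
  simp [h2]

theorem tendsto_charFun_noncentralChiSq {Ω : Type*} [MeasurableSpace Ω] {P : Measure Ω}
    {X : ℕ → Ω → ℝ} {N : ℕ → ℕ} {δ : ℝ} (hXm : ∀ n, AEMeasurable (X n) P)
    (hX : ∀ n, P.map (X n) = noncentralChiSq (N n) (fun _ => δ)) {a : ℕ → ℝ} {L : ℝ}
    (hN : Tendsto (fun n => (N n : ℝ)) atTop atTop)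
    (ha : Tendsto (fun n => (N n : ℝ) * a n ^ 2) atTop (𝓝 L)) (t : ℝ) :
    Tendsto (fun n => charFun (P.map fun ω => a n * (X n ω - N n * (1 + δ ^ 2))) t) atTop
      (𝓝 (Complex.exp (-((L * (2 + 4 * δ ^ 2) * t ^ 2 : ℝ) : ℂ) / 2))) := by
  set v : ℝ := 2 + 4 * δ ^ 2 with hv
  have hv0 : 0 < v := by positivity
  have hsq : √v * √v = v := Real.mul_self_sqrt hv0.le
  have hsv : √v ≠ 0 := (Real.sqrt_pos.2 hv0).ne'
  have ha2 : Tendsto (fun n => a n ^ 2) atTop (𝓝 0) := by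
    refine (ha.div_atTop hN).congr' ?_
    filter_upwards [hN.eventually_gt_atTop 0] with n hn
    field_simp
  have ha0 : Tendsto a atTop (𝓝 0) := by
    have := (Real.continuous_sqrt.tendsto 0).comp ha2
    rw [Real.sqrt_zero] at this
    refine (tendsto_zero_iff_abs_tendsto_zero _).2 (this.congr fun n => ?_)
    simp [Real.sqrt_sq_eq_abs]
  have key := tendsto_charFun_pow_of_tendsto_mul_sq (P := gaussianReal 0 1)
    (U := fun z => (√v)⁻¹ * ((z + δ) ^ 2 - (1 + δ ^ 2))) (by fun_prop)
    (by simp only [integral_const_mul, integral_sq_add_sub, mul_zero])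
    (by
      simp only [Pi.pow_apply, mul_pow, integral_const_mul, integral_sq_sq_add_sub]
      rw [inv_pow, sq, hsq, ← hv, inv_mul_cancel₀ hv0.ne'])
    (N := N) (s := fun n => √v * (a n * t)) (L := L * v * t ^ 2)
    (by simpa using (ha0.mul_const t).const_mul √v)
    (by
      refine ((ha.mul_const v).mul_const (t ^ 2)).congr fun n => ?_
      rw [mul_pow, sq √v, hsq]; ring)
  refine key.congr fun n => ?_
  rw [charFun_map_const_mul_sub_noncentralChiSq (hXm n) (hX n), charFun_map_mul_comp (by fun_prop),
    inv_mul_cancel_left₀ hsv]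

theorem tendstoInMeasure_of_tendstoInDistribution_const {Ω : Type*} [MeasurableSpace Ω]
    {P : Measure Ω} [IsProbabilityMeasure P] {V : ℕ → Ω → ℝ} {a : ℝ}
    (h : TendstoInDistribution V atTop (fun _ : Ω => a) (fun _ => P) P) :
    TendstoInMeasure P V atTop fun _ => a := by
  rw [tendstoInMeasure_iff_norm]
  intro ε hε
  have hF : IsClosed {x : ℝ | ε ≤ ‖x - a‖} := isClosed_le (by fun_prop) (by fun_prop)
  have hdirac : ∀ s ⊆ {x : ℝ | ε ≤ ‖x - a‖}, P.map (fun _ : Ω => a) s = 0 := by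
    intro s hs
    refine measure_mono_null hs ?_
    rw [Measure.map_apply (by fun_prop) hF.measurableSet]
    simp [hε.not_ge]
  have := ProbabilityMeasure.tendsto_measure_of_null_frontier_of_tendsto' h.tendsto
    (E := {x : ℝ | ε ≤ ‖x - a‖}) (hdirac _ hF.frontier_subset)
  simp only [ProbabilityMeasure.coe_mk, hdirac _ subset_rfl] at this
  refine this.congr fun n => ?_
  rw [Measure.map_apply_of_aemeasurable (h.forall_aemeasurable n) hF.measurableSet]
  rfl

theorem tendstoInDistribution_of_tendsto_charFun {Ω Ω' : Type*} [MeasurableSpace Ω]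
    [MeasurableSpace Ω'] {P : Measure Ω} [IsProbabilityMeasure P] {Q : Measure Ω'}
    [IsProbabilityMeasure Q] {V : ℕ → Ω → ℝ} {Z : Ω' → ℝ} (hV : ∀ n, AEMeasurable (V n) P)
    (hZ : AEMeasurable Z Q)
    (h : ∀ t, Tendsto (fun n => charFun (P.map (V n)) t) atTop (𝓝 (charFun (Q.map Z) t))) :
    TendstoInDistribution V atTop Z (fun _ => P) Q :=
  ⟨hV, hZ, ProbabilityMeasure.tendsto_iff_tendsto_charFun.2 h⟩

theorem chiSqMeasure_eq_noncentralChiSq (d : ℕ) :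
    chiSqMeasure d = noncentralChiSq d fun _ => 0 := by
  simp [chiSqMeasure, noncentralChiSq]

instance isProbabilityMeasure_noncentralChiSq (d : ℕ) (μ : Fin d → ℝ) :
    IsProbabilityMeasure (noncentralChiSq d μ) :=
  Measure.isProbabilityMeasure_map (Measurable.aemeasurable (by fun_prop))

theorem tendstoInMeasure_chiSq_div {Ω : Type*} [MeasurableSpace Ω] {P : Measure Ω}
    [IsProbabilityMeasure P] {Y : ℕ → Ω → ℝ} {m : ℕ → ℕ} (hYm : ∀ n, AEMeasurable (Y n) P)
    (hY : ∀ n, P.map (Y n) = noncentralChiSq (m n) (fun _ => 0)) (hm0 : ∀ n, m n ≠ 0)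
    (hm : Tendsto (fun n => (m n : ℝ)) atTop atTop) :
    TendstoInMeasure P (fun n ω => Y n ω / m n) atTop fun _ => 1 := by
  have hd : TendstoInDistribution
      (fun n ω => (m n : ℝ)⁻¹ * (Y n ω - m n * (1 + 0 ^ 2))) atTop (fun _ : Ω => (0 : ℝ))
      (fun _ => P) P := by
    refine tendstoInDistribution_of_tendsto_charFun (fun n => by fun_prop) (by fun_prop)
      fun t => ?_
    have h := tendsto_charFun_noncentralChiSq hYm hY (a := fun n => (m n : ℝ)⁻¹) (L := 0) hm
      (by
        refine (tendsto_inv_atTop_zero.comp hm).congr fun n => ?_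
        have : (m n : ℝ) ≠ 0 := Nat.cast_ne_zero.2 (hm0 n)
        simp only [Function.comp_apply]
        field_simp) t
    simpa using h
  have h := tendstoInMeasure_of_tendstoInDistribution_const hd
  rw [tendstoInMeasure_iff_norm] at h ⊢
  intro ε hε
  refine (h ε hε).congr fun n => ?_
  have : (m n : ℝ) ≠ 0 := Nat.cast_ne_zero.2 (hm0 n)
  have heq (ω : Ω) : (m n : ℝ)⁻¹ * (Y n ω - m n * (1 + 0 ^ 2)) - 0 = Y n ω / m n - 1 := by
    field_simp
    ring
  simp_rw [heq]

/-- The asymptotic distribution of the ratio of a noncentral and a central chi-square variable,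
when the degrees of freedom grow proportionally. -/
theorem tendstoInDistribution_noncentralChiSq_div_chiSq {Ω : Type*} [MeasurableSpace Ω]
    {P : Measure Ω} [IsProbabilityMeasure P] {X Y : ℕ → Ω → ℝ} {p m : ℕ → ℕ} {δ r : ℝ}
    (hX : ∀ n, P.map (X n) = noncentralChiSq (p n) (fun _ => δ))
    (hY : ∀ n, P.map (Y n) = chiSqMeasure (m n))
    (hindep : ∀ n, IndepFun (X n) (Y n) P) (hm0 : ∀ n, m n ≠ 0)
    (hp : Tendsto (fun n => (p n : ℝ)) atTop atTop)
    (hm : Tendsto (fun n => (m n : ℝ)) atTop atTop)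
    (hr : Tendsto (fun n => (p n : ℝ) / m n) atTop (𝓝 r)) :
    TendstoInDistribution
      (fun n ω => √(p n) * (X n ω / Y n ω - p n / m n * (1 + δ ^ 2))) atTop id (fun _ => P)
      (gaussianReal 0 (2 * r ^ 2 * (1 + 2 * δ ^ 2 + r * (1 + δ ^ 2) ^ 2)).toNNReal) := by
  simp_rw [chiSqMeasure_eq_noncentralChiSq] at hY
  have hr0 : 0 ≤ r := ge_of_tendsto' hr fun n => by positivity
  have hXm (n : ℕ) : AEMeasurable (X n) P := aemeasurable_of_map_neZero (by
    rw [hX]; infer_instance)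
  have hYm (n : ℕ) : AEMeasurable (Y n) P := aemeasurable_of_map_neZero (by
    rw [hY]; infer_instance)
  have hmpos (n : ℕ) : (0 : ℝ) < m n := by exact_mod_cast Nat.pos_of_ne_zero (hm0 n)
  have hsq (n : ℕ) : √(p n : ℝ) ^ 2 = p n := Real.sq_sqrt (Nat.cast_nonneg _)
  set a : ℕ → ℝ := fun n => √(p n) / m n with ha
  set b : ℕ → ℝ := fun n => -(√(p n) * p n * (1 + δ ^ 2) / (m n) ^ 2) with hb
  set A : ℕ → Ω → ℝ := fun n ω => a n * (X n ω - p n * (1 + δ ^ 2)) with hA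
  set B : ℕ → Ω → ℝ := fun n ω => b n * (Y n ω - m n * (1 + 0 ^ 2)) with hB
  set v := 2 * r ^ 2 * (1 + 2 * δ ^ 2 + r * (1 + δ ^ 2) ^ 2) with hv
  have hv0 : 0 ≤ v := by positivity
  have haL : Tendsto (fun n => (p n : ℝ) * a n ^ 2) atTop (𝓝 (r ^ 2)) := by
    refine (hr.pow 2).congr fun n => ?_
    simp only [ha, div_pow, hsq]
    ring
  have hbL : Tendsto (fun n => (m n : ℝ) * b n ^ 2) atTop (𝓝 (r ^ 3 * (1 + δ ^ 2) ^ 2)) := by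
    refine ((hr.pow 3).mul_const ((1 + δ ^ 2) ^ 2)).congr fun n => ?_
    have := (hmpos n).ne'
    simp only [hb, neg_sq, div_pow, mul_pow, hsq]
    field_simp
  have hW : TendstoInDistribution (fun n ω => A n ω + B n ω) atTop id (fun _ => P)
      (gaussianReal 0 v.toNNReal) := by
    refine tendstoInDistribution_of_tendsto_charFun (fun n => by fun_prop) (by fun_prop)
      fun t => ?_
    have h := (tendsto_charFun_noncentralChiSq hXm hX hp haL t).mul
      (tendsto_charFun_noncentralChiSq hYm hY hm hbL t)
    rw [← Complex.exp_add] at h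
    rw [Measure.map_id, charFun_gaussianReal]
    convert! h using 2 with n
    · have hi : IndepFun (A n) (B n) P :=
        (hindep n).comp (φ := fun x => a n * (x - p n * (1 + δ ^ 2)))
          (ψ := fun y => b n * (y - m n * (1 + 0 ^ 2))) (by fun_prop) (by fun_prop)
      rw [hi.charFun_map_fun_add_eq_mul (by fun_prop) (by fun_prop)]
      rfl
    · rw [Real.coe_toNNReal _ hv0, hv]
      push_cast
      ring_nf
  have hV := tendstoInMeasure_chiSq_div hYm hY hm0 hm
  have hG := hW.continuous_comp_prodMk_of_tendstoInMeasure_const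
    (g := fun x : ℝ × ℝ => x.1 / max x.2 (1 / 2))
    (continuous_fst.div (by fun_prop) fun x => (lt_max_of_lt_right (by norm_num)).ne') hV
    (fun n => by fun_prop)
  simp only [id_eq, show max (1 : ℝ) (1 / 2) = 1 by norm_num, div_one] at hG
  refine tendstoInDistribution_of_tendstoInMeasure_sub _ _ hG ?_ fun n => by fun_prop
  rw [tendstoInMeasure_iff_norm] at hV ⊢
  intro ε hε
  refine tendsto_of_tendsto_of_tendsto_of_le_of_le tendsto_const_nhds (hV (1 / 2) (by norm_num))
    (fun _ => zero_le) fun n => measure_mono fun ω hω => ?_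
  by_contra hlt
  simp only [Set.mem_ofPred_eq, not_le, Real.norm_eq_abs, abs_lt] at hlt
  have hgt : 1 / 2 < Y n ω / m n := by linarith [hlt.1]
  have hY0 : Y n ω ≠ 0 := fun h0 => by norm_num [h0] at hgt
  have hm' := (hmpos n).ne'
  have heq : √(p n) * (X n ω / Y n ω - p n / m n * (1 + δ ^ 2))
      = (A n ω + B n ω) / max (Y n ω / m n) (1 / 2) := by
    rw [max_eq_left hgt.le]
    simp only [hA, hB, ha, hb]
    field_simp
    ring
  simp only [Set.mem_ofPred_eq, Pi.sub_apply, Pi.zero_apply, sub_zero, heq, sub_self,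
    norm_zero] at hω
  exact hε.not_ge hω

/-- For independent `X n ~ χ²(p n; p n δ²)` and `Y n ~ χ²(m̃ n)` with `m̃ n = n−k n−p n+1`,
`p n/n → c ∈ (0,1)`, `k n/n → α`, `α+c<1`, `δ ≥ 0` fixed,
`√p (Xₙ/Yₙ − (p/m̃)(1+δ²))` converges in distribution to
`N(0, 2c²[(1−α)(1+2δ²)+cδ⁴]/(1−α−c)³)`. -/
theorem stmt10 {Ω : Type*} [MeasurableSpace Ω] (P : Measure Ω) [IsProbabilityMeasure P]
    (p k : ℕ → ℕ) (c α δ : ℝ) (hc : 0 < c) (hc1 : c < 1) (hα : 0 ≤ α) (hα1 : α < 1)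
    (hαc : α + c < 1) (hδ : 0 ≤ δ)
    (hkp : ∀ n, k n + p n ≤ n)
    (hp : Tendsto (fun n => (p n : ℝ) / n) atTop (𝓝 c))
    (hk : Tendsto (fun n => (k n : ℝ) / n) atTop (𝓝 α))
    (X Y : ℕ → Ω → ℝ)
    (hX : ∀ n, Measure.map (X n) P = noncentralChiSq (p n) (fun _ => δ))
    (hY : ∀ n, Measure.map (Y n) P = chiSqMeasure (n - k n - p n + 1))
    (hindep : ∀ n, IndepFun (X n) (Y n) P) :
    ∀ f : BoundedContinuousFunction ℝ ℝ,
      Tendsto (fun n => ∫ ω, f (Real.sqrt (p n) *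
            (X n ω / Y n ω - ((p n : ℝ) / ((n : ℝ) - k n - p n + 1)) * (1 + δ ^ 2))) ∂P)
        atTop
        (𝓝 (∫ x, f x ∂(gaussianReal 0
          (Real.toNNReal (2 * c ^ 2 * ((1 - α) * (1 + 2 * δ ^ 2) + c * δ ^ 4)
            / (1 - α - c) ^ 3))))) := by
  intro f
  have hcast (n : ℕ) : (n : ℝ) - k n - p n + 1 = ((n - k n - p n + 1 : ℕ) : ℝ) := by
    have := hkp n
    rw [Nat.sub_sub]
    push_cast [this]
    ring
  have hd : 0 < 1 - α - c := by linarith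
  have hnat : Tendsto (fun n : ℕ => (n : ℝ)) atTop atTop := tendsto_natCast_atTop_atTop
  have hpT : Tendsto (fun n => (p n : ℝ)) atTop atTop := by
    refine (hp.pos_mul_atTop hc hnat).congr' ?_
    filter_upwards [eventually_ne_atTop 0] with n hn
    field_simp
  have hmn : Tendsto (fun n : ℕ => ((n - k n - p n + 1 : ℕ) : ℝ) / n) atTop
      (𝓝 (1 - α - c)) := by
    have h := (((tendsto_const_nhds (x := (1 : ℝ))).sub hk).sub hp).add
      (tendsto_inv_atTop_zero.comp hnat)
    rw [add_zero] at h
    refine h.congr' ?_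
    filter_upwards [eventually_ne_atTop 0] with n hn
    rw [← hcast]
    simp only [Function.comp_apply]
    field_simp
  have hmT : Tendsto (fun n => ((n - k n - p n + 1 : ℕ) : ℝ)) atTop atTop := by
    refine (hmn.pos_mul_atTop hd hnat).congr' ?_
    filter_upwards [eventually_ne_atTop 0] with n hn
    field_simp
  have hr : Tendsto (fun n => (p n : ℝ) / (n - k n - p n + 1 : ℕ)) atTop
      (𝓝 (c / (1 - α - c))) := by
    refine (hp.div hmn hd.ne').congr' ?_
    filter_upwards [eventually_ne_atTop 0] with n hn
    exact div_div_div_cancel_right₀ (Nat.cast_ne_zero.2 hn) _ _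
  have h := tendstoInDistribution_noncentralChiSq_div_chiSq hX hY hindep
    (fun n => Nat.succ_ne_zero _) hpT hmT hr
  have hvar : 2 * (c / (1 - α - c)) ^ 2 * (1 + 2 * δ ^ 2 + c / (1 - α - c) * (1 + δ ^ 2) ^ 2)
      = 2 * c ^ 2 * ((1 - α) * (1 + 2 * δ ^ 2) + c * δ ^ 4) / (1 - α - c) ^ 3 := by
    field_simp
    ring
  rw [hvar] at h
  have hf := ProbabilityMeasure.tendsto_iff_forall_integral_tendsto.1 h.tendsto f
  simp only [ProbabilityMeasure.coe_mk, Measure.map_id] at hf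
  refine hf.congr fun n => ?_
  rw [integral_map (h.forall_aemeasurable n) (by fun_prop)]
  simp_rw [hcast]
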